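/- arXiv:2602.22601 — 3 statements merged into one kernel-verified Lean document; each statement's English description precedes it below -/
import Mathlib

section
/- Let μ and ν be probability measures on a measurable space with ν absolutely continuous with respect to μ, and let h be a Radon–Nikodym density of ν with respect to μ. Suppose M ≥ 1 and 1/M ≤ h ≤ M holds μ-almost everywhere. Then the Kullback–Leibler divergence D_KL(ν ‖ μ) = ∫ h·log h dμ satisfies D_KL(ν ‖ μ) ≥ (1/(2M)) · ∫ (h − 1)² dμ. -/
open MeasureTheory

theorem Real.add_sq_div_two_le_neg_log_one_sub {u : ℝ} (h0 : 0 ≤ u) (h1 : u < 1) :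
    u + u ^ 2 / 2 ≤ -Real.log (1 - u) := by
  have hs := Real.hasSum_pow_div_log_of_abs_lt_one (abs_lt.2 ⟨by linarith, h1⟩)
  have hle := sum_le_hasSum (Finset.range 2) (fun i _ => by positivity) hs
  norm_num [Finset.sum_range_succ] at hle
  linarith

theorem Real.sub_one_add_sq_div_le_mul_log {t M : ℝ} (ht : 0 < t) (htM : t ≤ M) (hM : 1 ≤ M) :
    (t - 1) + (1 / (2 * M)) * (t - 1) ^ 2 ≤ t * Real.log t := by
  rcases le_total t 1 with h1 | h1
  · have hlog := Real.sinh_le_self_iff.2 (Real.log_nonpos ht.le h1)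
    rw [Real.sinh_log ht] at hlog
    calc (t - 1) + (1 / (2 * M)) * (t - 1) ^ 2
        ≤ (t - 1) + (1 / (2 * 1)) * (t - 1) ^ 2 := by gcongr
      _ = t * ((t - t⁻¹) / 2) := by field_simp; ring
      _ ≤ t * Real.log t := by gcongr
  · have hlog := Real.add_sq_div_two_le_neg_log_one_sub (u := 1 - t⁻¹)
      (sub_nonneg.2 (inv_le_one_of_one_le₀ h1)) (sub_lt_self 1 (inv_pos.2 ht))
    rw [sub_sub_cancel, Real.log_inv, neg_neg] at hlog
    calc (t - 1) + (1 / (2 * M)) * (t - 1) ^ 2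
        ≤ (t - 1) + (1 / (2 * t)) * (t - 1) ^ 2 := by gcongr
      _ = t * ((1 - t⁻¹) + (1 - t⁻¹) ^ 2 / 2) := by field_simp
      _ ≤ t * Real.log t := by gcongr

theorem forward_kl_lower_bound_of_bounded_density
    {α : Type*} [MeasurableSpace α]
    (μ ν : Measure α) [IsProbabilityMeasure μ] [IsProbabilityMeasure ν]
    (hac : ν ≪ μ) (h : α → ℝ) (hmeas : Measurable h)
    (hdensity : ν = μ.withDensity (fun x => ENNReal.ofReal (h x)))
    (M : ℝ) (hM : 1 ≤ M)
    (hbound : ∀ᵐ x ∂μ, 1 / M ≤ h x ∧ h x ≤ M) :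
    ∫ x, h x * Real.log (h x) ∂μ ≥ (1 / (2 * M)) * ∫ x, (h x - 1) ^ 2 ∂μ := by
  have hMpos : 0 < 1 / M := by positivity
  have hpos : ∀ᵐ x ∂μ, 0 < h x := hbound.mono fun x hx => hMpos.trans_le hx.1
  have hmem : ∀ᵐ x ∂μ, h x ∈ Set.Icc (1 / M) M := hbound
  have integrable_h : Integrable h μ := Integrable.of_mem_Icc _ _ hmeas.aemeasurable hmem
  have integrable_sq : Integrable (fun x => (h x - 1) ^ 2) μ := by
    refine Integrable.of_mem_Icc 0 (M ^ 2) (by fun_prop) ?_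
    filter_upwards [hbound, hpos] with x hx hx0
    exact ⟨sq_nonneg _, by nlinarith⟩
  have integrable_log : Integrable (fun x => h x * Real.log (h x)) μ := by
    refine Integrable.of_mem_Icc (-1) (M * M) (by fun_prop) ?_
    filter_upwards [hbound, hpos] with x hx hx0
    have hlow := Real.one_sub_inv_le_log_of_pos hx0
    have hup := Real.log_le_sub_one_of_pos hx0
    constructor
    · calc (-1 : ℝ) ≤ h x * (1 - (h x)⁻¹) := by
            rw [mul_sub, mul_inv_cancel₀ hx0.ne']; linarith
        _ ≤ h x * Real.log (h x) := by gcongr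
    · calc h x * Real.log (h x) ≤ h x * M := by gcongr; linarith [hx.2]
        _ ≤ M * M := by gcongr; exact hx.2
  have hone : ∫ x, h x ∂μ = 1 := by
    have hν : ν Set.univ = 1 := measure_univ
    rw [hdensity, withDensity_apply _ MeasurableSet.univ, Measure.restrict_univ] at hν
    rw [integral_eq_lintegral_of_nonneg_ae (hpos.mono fun x hx => hx.le)
      hmeas.aestronglyMeasurable, hν, ENNReal.toReal_one]
  have integrable_sub : Integrable (fun x => h x - 1) μ := integrable_h.sub (integrable_const 1)
  calc (1 / (2 * M)) * ∫ x, (h x - 1) ^ 2 ∂μ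
      = ∫ x, ((h x - 1) + (1 / (2 * M)) * (h x - 1) ^ 2) ∂μ := by
        rw [integral_add integrable_sub (integrable_sq.const_mul _), integral_const_mul,
          integral_sub integrable_h (integrable_const 1), hone]
        simp
    _ ≤ ∫ x, h x * Real.log (h x) ∂μ := by
        refine integral_mono_ae (integrable_sub.add (integrable_sq.const_mul _)) integrable_log ?_
        filter_upwards [hbound, hpos] with x hx hx0
        exact Real.sub_one_add_sq_div_le_mul_log hx0 hx.2 hM
end

section
/- Let μ and ν be probability measures on a measurable space with ν absolutely continuous with respect to μ, and let h be a Radon–Nikodym density of ν with respect to μ. Suppose M ≥ 1 and 1/M ≤ h ≤ M holds μ-almost everywhere. Then the Kullback–Leibler divergence D_KL(μ ‖ ν) = ∫ (−log h) dμ satisfies D_KL(μ ‖ ν) ≤ (M²/2) · ∫ (h − 1)² dμ. -/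
open MeasureTheory

/-- A quadratic upper bound for `-log` around `1`, valid on `[1 / M, ∞)`. -/
lemma neg_log_le_one_sub_add_sq {M t : ℝ} (hM : 1 ≤ M) (ht : 1 / M ≤ t) :
    -Real.log t ≤ (1 - t) + M ^ 2 / 2 * (t - 1) ^ 2 := by
  have hM0 : 0 < M := by linarith
  have ht0 : 0 < t := lt_of_lt_of_le (by positivity) ht
  rcases le_total 1 t with h1 | h1
  · have hlog := Real.le_log_one_add_of_nonneg (sub_nonneg.2 h1)
    rw [add_sub_cancel] at hlog
    have hrat : (t - 1) - (t - 1) ^ 2 / 2 ≤ 2 * (t - 1) / (t - 1 + 2) := by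
      rw [le_div_iff₀ (by linarith)]
      nlinarith [pow_nonneg (sub_nonneg.2 h1) 3]
    have hM2 : (1 : ℝ) ≤ M ^ 2 := one_le_pow₀ hM
    nlinarith [mul_nonneg (sub_nonneg.2 hM2) (sq_nonneg (t - 1))]
  · have hsinh := Real.self_le_sinh_iff.2 (neg_nonneg.2 (Real.log_nonpos ht0.le h1))
    rw [← Real.log_inv, Real.sinh_log (inv_pos.2 ht0), inv_inv, Real.log_inv] at hsinh
    have hle : t⁻¹ ≤ M := by
      rw [one_div] at ht
      exact inv_le_of_inv_le₀ hM0 ht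
    have hsq : (t⁻¹) ^ 2 ≤ M ^ 2 := pow_le_pow_left₀ (by positivity) hle 2
    have hcube : 0 ≤ (t⁻¹ - 1) ^ 3 := pow_nonneg (sub_nonneg.2 ((one_le_inv₀ ht0).2 h1)) 3
    have hid : (1 - t) + (t⁻¹) ^ 2 / 2 * (t - 1) ^ 2 - (t⁻¹ - t) / 2
        = t * (t⁻¹ - 1) ^ 3 / 2 := by
      field_simp
      ring
    nlinarith [mul_nonneg ht0.le hcube, mul_nonneg (sub_nonneg.2 hsq) (sq_nonneg (t - 1))]

theorem reverse_kl_upper_bound_of_bounded_density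
    {α : Type*} [MeasurableSpace α]
    (μ ν : Measure α) [IsProbabilityMeasure μ] [IsProbabilityMeasure ν]
    (hac : ν ≪ μ) (h : α → ℝ) (hmeas : Measurable h)
    (hdensity : ν = μ.withDensity (fun x => ENNReal.ofReal (h x)))
    (M : ℝ) (hM : 1 ≤ M)
    (hbound : ∀ᵐ x ∂μ, 1 / M ≤ h x ∧ h x ≤ M) :
    ∫ x, -Real.log (h x) ∂μ ≤ (M ^ 2 / 2) * ∫ x, (h x - 1) ^ 2 ∂μ := by
  have hM0 : 0 < 1 / M := by positivity
  have hint : Integrable h μ :=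
    Integrable.of_mem_Icc (1 / M) M hmeas.aemeasurable hbound
  have hint_sq : Integrable (fun x => (h x - 1) ^ 2) μ := by
    refine Integrable.of_mem_Icc 0 (M ^ 2) (by fun_prop) ?_
    filter_upwards [hbound] with x hx
    exact ⟨sq_nonneg _, by nlinarith⟩
  have hint_log : Integrable (fun x => -Real.log (h x)) μ := by
    refine Integrable.of_mem_Icc (-Real.log M) (-Real.log (1 / M))
      hmeas.log.neg.aemeasurable ?_
    filter_upwards [hbound] with x hx
    exact ⟨neg_le_neg (Real.log_le_log (hM0.trans_le hx.1) hx.2),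
      neg_le_neg (Real.log_le_log hM0 hx.1)⟩
  have hone : ∫ x, h x ∂μ = 1 := by
    have hν : ν Set.univ = 1 := measure_univ
    rw [hdensity, withDensity_apply _ MeasurableSet.univ, Measure.restrict_univ] at hν
    rw [integral_eq_lintegral_of_nonneg_ae _ hmeas.aestronglyMeasurable, hν,
      ENNReal.toReal_one]
    filter_upwards [hbound] with x hx
    exact hM0.le.trans hx.1
  have hint_sub : Integrable (fun x => 1 - h x) μ := (integrable_const 1).sub hint
  calc ∫ x, -Real.log (h x) ∂μ
      ≤ ∫ x, ((1 - h x) + M ^ 2 / 2 * (h x - 1) ^ 2) ∂μ := by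
        refine integral_mono_ae hint_log (hint_sub.add (hint_sq.const_mul _)) ?_
        filter_upwards [hbound] with x hx
        exact neg_log_le_one_sub_add_sq hM hx.1
    _ = M ^ 2 / 2 * ∫ x, (h x - 1) ^ 2 ∂μ := by
        rw [integral_add hint_sub (hint_sq.const_mul _),
          integral_sub (integrable_const 1) hint, integral_const_mul, hone]
        simp
end

section
/- Let μ and ν be probability measures on a measurable space with ν absolutely continuous with respect to μ, and let h be a Radon–Nikodym density of ν with respect to μ. Suppose M ≥ 1 and 1/M ≤ h ≤ M holds μ-almost everywhere. Then D_KL(ν ‖ μ) ≥ (1/M³) · D_KL(μ ‖ ν), where D_KL(ν ‖ μ) = ∫ h·log h dμ and D_KL(μ ‖ ν) = ∫ (−log h) dμ. -/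
open MeasureTheory

/-- The generator `u log u + 1 - u` of the forward divergence dominates `c` times the generator
`u - 1 - log u` of the reverse divergence, for `0 ≤ c ≤ min 1 u`. -/
lemma Real.mul_sub_one_sub_log_le_mul_log_add {c u : ℝ} (hc0 : 0 ≤ c) (hc1 : c ≤ 1)
    (hcu : c ≤ u) (hu : 0 < u) : c * (u - 1 - log u) ≤ u * log u + 1 - u := by
  suffices 0 ≤ (u + c) * log u - (1 + c) * (u - 1) by linarith
  rcases le_total 1 u with h1 | h1
  · have key := le_log_one_add_of_nonneg (sub_nonneg.2 h1)
    rw [add_sub_cancel, div_le_iff₀ (by linarith)] at key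
    have h2 := mul_le_mul_of_nonneg_left key (by linarith : 0 ≤ u + c)
    have h3 := mul_nonneg (mul_self_nonneg (u - 1)) (sub_nonneg.2 hc1)
    exact le_of_mul_le_mul_left (a := u + 1) (by linarith) (by linarith)
  · have key := self_le_sinh_iff.2 (neg_nonneg.2 (log_nonpos hu.le h1))
    rw [sinh_neg, neg_le_neg_iff, sinh_log hu] at key
    have hinv : u * u⁻¹ = 1 := mul_inv_cancel₀ hu.ne'
    have key' : u * u - 1 ≤ 2 * u * log u := by
      have := mul_le_mul_of_nonneg_left key (by linarith : 0 ≤ 2 * u)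
      linarith
    have h2 := mul_le_mul_of_nonneg_left key' (by linarith : 0 ≤ u + c)
    have h3 := mul_nonneg (mul_self_nonneg (u - 1)) (sub_nonneg.2 hcu)
    exact le_of_mul_le_mul_left (a := 2 * u) (by linarith) (by linarith)

theorem forward_kl_ge_inv_M_cubed_mul_reverse_kl
    {α : Type*} [MeasurableSpace α]
    (μ ν : Measure α) [IsProbabilityMeasure μ] [IsProbabilityMeasure ν]
    (hac : ν ≪ μ) (h : α → ℝ) (hmeas : Measurable h)
    (hdensity : ν = μ.withDensity (fun x => ENNReal.ofReal (h x)))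
    (M : ℝ) (hM : 1 ≤ M)
    (hbound : ∀ᵐ x ∂μ, 1 / M ≤ h x ∧ h x ≤ M) :
    ∫ x, h x * Real.log (h x) ∂μ ≥ (1 / M ^ 3) * ∫ x, -Real.log (h x) ∂μ := by
  have hM0 : 0 < M := by linarith
  have hMinv : 0 < 1 / M := by positivity
  have hc : 1 / M ^ 3 ≤ 1 / M :=
    one_div_le_one_div_of_le hM0 (le_self_pow₀ hM (by norm_num))
  have hc1 : 1 / M ≤ 1 := (div_le_one hM0).2 hM
  have hint : Integrable h μ :=
    Integrable.of_mem_Icc (1 / M) M hmeas.aemeasurable hbound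
  have hlog : Integrable (fun x => Real.log (h x)) μ := by
    refine Integrable.of_mem_Icc (Real.log (1 / M)) (Real.log M)
      hmeas.log.aemeasurable ?_
    filter_upwards [hbound] with x hx
    exact ⟨Real.log_le_log hMinv hx.1, Real.log_le_log (hMinv.trans_le hx.1) hx.2⟩
  have hmul : Integrable (fun x => h x * Real.log (h x)) μ := by
    refine hlog.bdd_mul (c := M) hmeas.aestronglyMeasurable ?_
    filter_upwards [hbound] with x hx
    rw [Real.norm_of_nonneg (hMinv.le.trans hx.1)]
    exact hx.2
  have hone : ∫ x, h x ∂μ = 1 := by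
    rw [integral_eq_lintegral_of_nonneg_ae
      (hbound.mono fun x hx => hMinv.le.trans hx.1) hmeas.aestronglyMeasurable,
      ← setLIntegral_univ, ← withDensity_apply _ MeasurableSet.univ, ← hdensity]
    simp
  have hmono : ∫ x, 1 / M ^ 3 * (h x - 1 - Real.log (h x)) ∂μ
      ≤ ∫ x, (h x * Real.log (h x) + 1 - h x) ∂μ := by
    refine integral_mono_ae
      (((hint.sub (integrable_const 1)).sub hlog).const_mul _)
      ((hmul.add (integrable_const 1)).sub hint) ?_
    filter_upwards [hbound] with x hx
    exact Real.mul_sub_one_sub_log_le_mul_log_add (by positivity) (hc.trans hc1)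
      (hc.trans hx.1) (hMinv.trans_le hx.1)
  rw [integral_const_mul, integral_sub (f := fun x => h x - 1) (hint.sub (integrable_const 1)) hlog,
    integral_sub hint (integrable_const 1),
    integral_sub (f := fun x => h x * Real.log (h x) + 1)
      (hmul.add (integrable_const 1)) hint,
    integral_add hmul (integrable_const 1), hone] at hmono
  rw [integral_neg]
  simpa using hmono
end
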